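/- arXiv:1307.7986 — 4 statements merged into one kernel-verified Lean document; each statement's English description precedes it below -/
import Mathlib

section
/- Let (c₁,…,cₙ) ∈ 𝒜⁺ be an η-sequence. Then the matrix product η(c₁)η(c₂)⋯η(cₙ) equals −I, where I is the 2×2 identity matrix over ℤ. -/
open Matrix Finset

/-- The matrix `η(a)` with rows `(a, -1)` and `(1, 0)`. -/
def etaM (a : ℤ) : Matrix (Fin 2) (Fin 2) ℤ := !![a, -1; 1, 0]

/-- The set `𝒜⁺` of η-sequences, as an inductive predicate on lists of integers. -/
inductive IsEta : List ℤ → Prop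
  | base : IsEta [0, 0]
  | rotate {c : List ℤ} : IsEta c → IsEta (c.rotate 1)
  | reverse {c : List ℤ} : IsEta c → IsEta c.reverse
  | expand {a b : ℤ} {t : List ℤ} : IsEta (a :: b :: t) → IsEta ((a + 1) :: 1 :: (b + 1) :: t)

/-- The `i`-th entry (1-indexed) of a sequence. -/
def entryOf (c : List ℤ) (i : ℕ) : ℤ := c.getD (i - 1) 0

/-- `φ_i(j)`: `0` if `i = j`; the (2,1)-entry of `η(c_i)⋯η(c_{j-1})` if `i < j`;
the (2,1)-entry of `η(c_j)⋯η(c_{i-1})` if `j < i`.  (Indices are 1-based.) -/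
def phi (c : List ℤ) (i j : ℕ) : ℤ :=
  if i = j then 0
  else if i < j then (((c.drop (i - 1)).take (j - i)).map etaM).prod 1 0
  else (((c.drop (j - 1)).take (i - j)).map etaM).prod 1 0

open Classical in
/-- `m_i`: the set of positions `j ∈ {1,…,n}` where `φ_i` attains its maximum. -/
noncomputable def mset (c : List ℤ) (i : ℕ) : Finset ℕ :=
  (Finset.Icc 1 c.length).filter (fun j => ∀ l ∈ Finset.Icc 1 c.length, phi c i l ≤ phi c i j)

/-- `i ⊕ k`: addition of 1-based indices, wrapping around modulo `n` (for `i + k ≤ 2n`). -/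
def addIdx (n i k : ℕ) : ℕ := if i + k ≤ n then i + k else i + k - n

/-- `c` is dense if for every `i ∈ {1,…,n}`, `|m_i| > 1` or `|m_{i+1}| > 1`
(indices taken cyclically). -/
def DenseSeq (c : List ℤ) : Prop :=
  ∀ i ∈ Finset.Icc 1 c.length,
    1 < (mset c i).card ∨ 1 < (mset c (addIdx c.length i 1)).card

/-- `c` is fan-shaped if a cyclic rotation of `c` equals `(n-2, 1, 2, …, 2, 1)`. -/
def IsFan (c : List ℤ) : Prop :=
  ∃ k, c.rotate k =
    ((c.length : ℤ) - 2) :: 1 :: (List.replicate (c.length - 3) (2 : ℤ) ++ [1])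

theorem etaM_add_one_mul_etaM_one_mul (a b : ℤ) :
    etaM (a + 1) * (etaM 1 * etaM (b + 1)) = etaM a * etaM b := by
  ext i j
  fin_cases i <;> fin_cases j <;> simp [etaM, Matrix.mul_apply, Fin.sum_univ_two]; ring

theorem conj_transpose_etaM (a : ℤ) :
    !![1, 0; 0, -1] * (etaM a)ᵀ * !![1, 0; 0, -1] = etaM a := by
  ext i j
  fin_cases i <;> fin_cases j <;> simp [etaM, Matrix.mul_apply, Matrix.vecMul, dotProduct]

theorem diag_one_neg_one_mul_self :
    (!![1, 0; 0, -1] * !![1, 0; 0, -1] : Matrix (Fin 2) (Fin 2) ℤ) = 1 := by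
  decide

theorem prod_map_etaM_reverse (c : List ℤ) :
    (c.reverse.map etaM).prod = !![1, 0; 0, -1] * (c.map etaM).prodᵀ * !![1, 0; 0, -1] := by
  induction c with
  | nil => simpa using diag_one_neg_one_mul_self.symm
  | cons a t ih =>
    simp only [List.reverse_cons, List.map_append, List.prod_append, List.map_cons, List.map_nil,
      List.prod_cons, List.prod_nil, mul_one, Matrix.transpose_mul]
    rw [ih]
    nth_rewrite 1 [← conj_transpose_etaM a]
    have hJ := diag_one_neg_one_mul_self
    generalize (!![1, 0; 0, -1] : Matrix (Fin 2) (Fin 2) ℤ) = J at hJ ⊢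
    simp only [mul_assoc]
    rw [← mul_assoc J J, hJ, one_mul]

theorem eta_prod_eq_neg_id (c : List ℤ) (h : IsEta c) :
    (c.map etaM).prod = -(1 : Matrix (Fin 2) (Fin 2) ℤ) := by
  induction h with
  | base => decide
  | @rotate c _ ih =>
    cases c with
    | nil => simpa using ih
    | cons a t =>
      simp only [List.map_cons, List.prod_cons] at ih
      simp only [List.rotate_cons_succ, List.rotate_zero, List.map_append, List.prod_append,
        List.map_cons, List.map_nil, List.prod_cons, List.prod_nil, mul_one]
      rw [← neg_eq_iff_eq_neg, ← mul_neg] at ih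
      rw [← neg_eq_iff_eq_neg, ← neg_mul]
      exact mul_eq_one_comm.mp ih
  | reverse _ ih =>
    rw [prod_map_etaM_reverse, ih, Matrix.transpose_neg, Matrix.transpose_one, mul_neg, mul_one,
      neg_mul, diag_one_neg_one_mul_self]
  | @expand a b t _ ih =>
    simp only [List.map_cons, List.prod_cons] at ih ⊢
    rw [← ih, ← mul_assoc (etaM a), ← etaM_add_one_mul_etaM_one_mul]
    simp only [mul_assoc]
end

section
/- Let c = (c₁,…,cₙ) ∈ 𝒜⁺ with n ≥ 3, and let i ∈ {1,…,n−2} be such that c_{i+1} = 1. Then φ_{i+1}(j) = φ_i(j) + φ_{i+2}(j) for every j ∈ {1,…,n} with j ≠ i+1. -/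
open Matrix Finset

theorem phi_of_le (c : List ℤ) {i j : ℕ} (hij : i ≤ j) :
    phi c i j = (((c.drop (i - 1)).take (j - i)).map etaM).prod 1 0 := by
  rcases hij.eq_or_lt with rfl | hlt
  · simp [phi]
  · simp [phi, hlt, hlt.ne]

theorem phi_of_ge (c : List ℤ) {i j : ℕ} (hji : j ≤ i) :
    phi c i j = (((c.drop (j - 1)).take (i - j)).map etaM).prod 1 0 := by
  rcases hji.eq_or_lt with rfl | hlt
  · simp [phi]
  · simp [phi, hlt.ne', hlt.not_gt]

theorem phi_ear_add (c : List ℤ) (h : IsEta c) (hn : 3 ≤ c.length)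
    (i : ℕ) (hi : i ∈ Finset.Icc 1 (c.length - 2)) (hc : entryOf c (i + 1) = 1) :
    ∀ j ∈ Finset.Icc 1 c.length, j ≠ i + 1 →
      phi c (i + 1) j = phi c i j + phi c (i + 2) j := by
  intro j hj hne
  obtain ⟨hi1, hi2⟩ := Finset.mem_Icc.mp hi
  obtain ⟨hj1, hj2⟩ := Finset.mem_Icc.mp hj
  obtain ⟨p, rfl⟩ : ∃ p, i = p + 1 := ⟨i - 1, by omega⟩
  have hp : p + 1 < c.length := by omega
  have hone : (c)[p + 1] = 1 := by
    simpa [entryOf, List.getElem?_eq_getElem hp] using hc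
  rcases Nat.lt_or_gt_of_ne hne with hlt | hgt
  · obtain ⟨r, rfl⟩ : ∃ r, j = r + 1 := ⟨j - 1, by omega⟩
    obtain ⟨q, rfl⟩ : ∃ q, p = r + q := ⟨p - r, by omega⟩
    have take_one : (c.drop r).take (q + 1) = (c.drop r).take q ++ [(c)[r + q]] := by
      rw [List.take_succ_eq_append_getElem (by simp; omega), List.getElem_drop]
    have take_two :
        (c.drop r).take (q + 2) = (c.drop r).take q ++ [(c)[r + q], 1] := by
      rw [List.take_succ_eq_append_getElem (by simp; omega), take_one, List.getElem_drop]
      simp [← hone, add_assoc]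
    rw [phi_of_ge c (by omega), phi_of_ge c (by omega), phi_of_ge c (by omega),
      show r + 1 - 1 = r by omega, show r + q + 1 + 1 - (r + 1) = q + 1 by omega,
      show r + q + 1 - (r + 1) = q by omega, show r + q + 1 + 2 - (r + 1) = q + 2 by omega,
      take_one, take_two]
    simp [etaM, Matrix.mul_apply, Fin.sum_univ_two]
    ring
  · obtain ⟨m, rfl⟩ : ∃ m, j = p + 3 + m := ⟨j - (p + 3), by omega⟩
    have drop_one : c.drop (p + 1) = 1 :: c.drop (p + 2) := by
      rw [List.drop_eq_getElem_cons hp, hone]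
    have drop_zero : c.drop p = (c)[p] :: 1 :: c.drop (p + 2) := by
      rw [List.drop_eq_getElem_cons (by omega), drop_one]
    rw [phi_of_le c (by omega), phi_of_le c (by omega), phi_of_le c (by omega),
      show p + 1 + 1 - 1 = p + 1 by omega, show p + 1 - 1 = p by omega,
      show p + 1 + 2 - 1 = p + 2 by omega, show p + 3 + m - (p + 1 + 1) = m + 1 by omega,
      show p + 3 + m - (p + 1) = m + 2 by omega, show p + 3 + m - (p + 1 + 2) = m by omega,
      drop_one, drop_zero]
    simp [etaM, Matrix.mul_apply, Matrix.vecMul, dotProduct, Fin.sum_univ_two]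
end

section
/- Let c = (c₁,…,cₙ) ∈ 𝒜⁺ and 1 ≤ i < j ≤ n, and assume that c_ℓ > 1 for all ℓ = i+1, …, j−1. Then φ_i(i) < φ_i(i+1) < ⋯ < φ_i(j−1) < φ_i(j), and φ_i(i) < φ_{i+1}(i) < ⋯ < φ_{j−1}(i) < φ_j(i). -/
open Matrix Finset

theorem phi_comm (c : List ℤ) (i j : ℕ) : phi c i j = phi c j i := by
  unfold phi
  split_ifs <;> first | rfl | omega

theorem phi_add_right (c : List ℤ) (i k : ℕ) :
    phi c i (i + k) = (((c.drop (i - 1)).take k).map etaM).prod 1 0 := by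
  rcases Nat.eq_zero_or_pos k with rfl | hk
  · simp [phi]
  · simp [phi, hk, hk.ne']

theorem prod_map_etaM_take_succ (c : List ℤ) (i k : ℕ) (hi : 1 ≤ i) (hk : i + k ≤ c.length) :
    (((c.drop (i - 1)).take (k + 1)).map etaM).prod =
      (((c.drop (i - 1)).take k).map etaM).prod * etaM (entryOf c (i + k)) := by
  have hlt : i - 1 + k < c.length := by omega
  have hidx : i + k - 1 = i - 1 + k := by omega
  simp [List.take_add_one, entryOf, hidx, hlt]

theorem mul_etaM_one_zero (A : Matrix (Fin 2) (Fin 2) ℤ) (a : ℤ) :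
    (A * etaM a) 1 0 = A 1 0 * a + A 1 1 := by
  simp [etaM, Matrix.mul_apply, Fin.sum_univ_two]

theorem mul_etaM_one_one (A : Matrix (Fin 2) (Fin 2) ℤ) (a : ℤ) :
    (A * etaM a) 1 1 = -A 1 0 := by
  simp [etaM, Matrix.mul_apply, Fin.sum_univ_two]

theorem phi_add_two (c : List ℤ) (i k : ℕ) (hi : 1 ≤ i) (hk : i + (k + 1) ≤ c.length) :
    phi c i (i + (k + 2)) = phi c i (i + (k + 1)) * entryOf c (i + (k + 1)) - phi c i (i + k) := by
  simp only [phi_add_right]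
  rw [prod_map_etaM_take_succ c i (k + 1) hi hk, mul_etaM_one_zero,
    prod_map_etaM_take_succ c i k hi (by omega), mul_etaM_one_one]
  ring

theorem phi_nonneg_and_lt_succ (c : List ℤ) (i j : ℕ) (hi : 1 ≤ i) (hj : j ≤ c.length)
    (hc : ∀ l, i < l → l < j → 1 < entryOf c l) (k : ℕ) (hk : i + k < j) :
    0 ≤ phi c i (i + k) ∧ phi c i (i + k) < phi c i (i + (k + 1)) := by
  induction k with
  | zero =>
    rw [phi_add_right, phi_add_right, prod_map_etaM_take_succ c i 0 hi (by omega)]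
    simp [etaM]
  | succ k ih =>
    obtain ⟨h0, h1⟩ := ih (by omega)
    have ha := hc (i + (k + 1)) (by omega) hk
    refine ⟨by omega, ?_⟩
    rw [phi_add_two c i k hi (by omega)]
    nlinarith

theorem phi_strictly_increasing (c : List ℤ) (h : IsEta c) (i j : ℕ)
    (hi : 1 ≤ i) (hij : i < j) (hj : j ≤ c.length)
    (hc : ∀ l, i < l → l < j → 1 < entryOf c l) :
    (∀ l, i ≤ l → l < j → phi c i l < phi c i (l + 1)) ∧
    (∀ l, i ≤ l → l < j → phi c l i < phi c (l + 1) i) := by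
  have key : ∀ l, i ≤ l → l < j → phi c i l < phi c i (l + 1) := by
    intro l hil hlj
    obtain ⟨k, rfl⟩ := Nat.exists_eq_add_of_le hil
    exact (phi_nonneg_and_lt_succ c i j hi hj hc k hlj).2
  refine ⟨key, fun l hil hlj => ?_⟩
  rw [phi_comm c l, phi_comm c (l + 1)]
  exact key l hil hlj
end

section
/- Let c = (c₁,…,cₙ) ∈ 𝒜⁺ be dense with n > 4. Then either (|m_i| = 1 for all odd i ∈ {1,…,n} and |m_i| = 2 for all even i ∈ {1,…,n}), or (|m_i| = 2 for all odd i ∈ {1,…,n} and |m_i| = 1 for all even i ∈ {1,…,n}). -/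
open Matrix Finset

/-- The determinant of the `i`-th and `j`-th vectors of the planar sequence `(p, q)`. -/
def wedge (p q : ℕ → ℤ) (i j : ℕ) : ℤ := p i * q j - q i * p j

/-- A sequence of vectors `(p 0, q 0), …, (p (n + 1), q (n + 1))` in the plane, continued
antiperiodically with period `n = c.length`, whose quiddity sequence is `c`. -/
structure Realizes (c : List ℤ) (p q : ℕ → ℤ) : Prop where
  p_length : p c.length = -p 0
  q_length : q c.length = -q 0
  p_length_succ : p (c.length + 1) = -p 1
  q_length_succ : q (c.length + 1) = -q 1
  p_rec : ∀ i < c.length, c.getD i 0 * p (i + 1) = p i + p (i + 2)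
  q_rec : ∀ i < c.length, c.getD i 0 * q (i + 1) = q i + q (i + 2)
  wedge_zero_one : wedge p q 0 1 = 1
  wedge_pos : ∀ i j, 1 ≤ i → i < j → j ≤ c.length → 0 < wedge p q i j

namespace Realizes

variable {c : List ℤ} {p q : ℕ → ℤ}

theorem wedge_succ (h : Realizes c p q) {i : ℕ} (hi : i ≤ c.length) :
    wedge p q i (i + 1) = 1 := by
  induction i with
  | zero => exact h.wedge_zero_one
  | succ i ih =>
    have h1 := h.p_rec i hi
    have h2 := h.q_rec i hi
    have h3 := ih (by omega)
    simp only [wedge] at h3 ⊢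
    linear_combination h3 - p (i + 1) * h2 + q (i + 1) * h1

theorem base : Realizes [0, 0] (fun i => [1, 0, -1, 0].getD i 0)
    (fun i => [0, 1, 0, -1].getD i 0) := by
  refine ⟨by simp, by simp, by simp, by simp, ?_, ?_, by simp [wedge], ?_⟩
  · intro i hi
    simp only [List.length_cons, List.length_nil] at hi
    interval_cases i <;> simp
  · intro i hi
    simp only [List.length_cons, List.length_nil] at hi
    interval_cases i <;> simp
  · intro i j h1 h2 h3
    simp only [List.length_cons, List.length_nil] at h3
    obtain rfl : i = 1 := by omega
    obtain rfl : j = 2 := by omega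
    simp [wedge]

theorem rotate (h : Realizes c p q) (hc : 2 ≤ c.length) :
    Realizes (c.rotate 1) (fun i => if i ≤ c.length then p (i + 1) else -p 2)
      (fun i => if i ≤ c.length then q (i + 1) else -q 2) := by
  have hp := h.p_length
  have hq := h.q_length
  have hp' := h.p_length_succ
  have hq' := h.q_length_succ
  have hget : ∀ i < c.length, (c.rotate 1).getD i 0 = c.getD ((i + 1) % c.length) 0 := by
    intro i hi
    rw [List.getD_eq_getElem _ _ (by simpa using hi), List.getElem_rotate,
      List.getD_eq_getElem _ _ (Nat.mod_lt _ (by omega))]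
  constructor
  · simp [hp']
  · simp [hq']
  · simp [show 1 ≤ c.length by omega]
  · simp [show 1 ≤ c.length by omega]
  · intro i hi
    rw [List.length_rotate] at hi
    rw [hget i hi]
    rcases eq_or_lt_of_le (show i + 1 ≤ c.length from hi) with e | e
    · have h0 := h.p_rec 0 (by omega)
      simp only [e, Nat.mod_self, le_refl, if_true, show i ≤ c.length by omega,
        show ¬ (i + 2 ≤ c.length) by omega, if_false, hp, hp']
      simp only [zero_add] at h0
      linear_combination -h0
    · have h0 := h.p_rec (i + 1) e
      simpa only [Nat.mod_eq_of_lt e, show i ≤ c.length by omega, show i + 1 ≤ c.length by omega,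
        show i + 2 ≤ c.length by omega, if_true] using h0
  · intro i hi
    rw [List.length_rotate] at hi
    rw [hget i hi]
    rcases eq_or_lt_of_le (show i + 1 ≤ c.length from hi) with e | e
    · have h0 := h.q_rec 0 (by omega)
      simp only [e, Nat.mod_self, le_refl, if_true, show i ≤ c.length by omega,
        show ¬ (i + 2 ≤ c.length) by omega, if_false, hq, hq']
      simp only [zero_add] at h0
      linear_combination -h0
    · have h0 := h.q_rec (i + 1) e
      simpa only [Nat.mod_eq_of_lt e, show i ≤ c.length by omega, show i + 1 ≤ c.length by omega,
        show i + 2 ≤ c.length by omega, if_true] using h0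
  · simpa [wedge, show 1 ≤ c.length by omega] using h.wedge_succ (i := 1) (by omega)
  · intro i j h1 h2 h3
    rw [List.length_rotate] at h3
    simp only [wedge, show i ≤ c.length by omega, h3, if_true]
    rcases eq_or_lt_of_le h3 with e | e
    · subst e
      have h0 := h.wedge_pos 1 (i + 1) le_rfl (by omega) (by omega)
      simp only [wedge] at h0
      rw [hp', hq']
      linarith
    · exact h.wedge_pos (i + 1) (j + 1) (by omega) (by omega) e

theorem reverse (h : Realizes c p q) :
    Realizes c.reverse (fun i => q (c.length + 1 - i)) (fun i => p (c.length + 1 - i)) := by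
  have hp := h.p_length
  have hq := h.q_length
  have hp' := h.p_length_succ
  have hq' := h.q_length_succ
  have hget : ∀ i < c.length, c.reverse.getD i 0 = c.getD (c.length - 1 - i) 0 := by
    intro i hi
    rw [List.getD_eq_getElem _ _ (by simpa using hi), List.getElem_reverse,
      List.getD_eq_getElem]
  constructor
  · simp [hq']
  · simp [hp']
  · simp [hq]
  · simp [hp]
  · intro i hi
    rw [List.length_reverse] at hi
    rw [hget i hi]
    obtain ⟨k, hk⟩ : ∃ k, c.length = i + k + 1 := ⟨c.length - i - 1, by omega⟩
    have h0 := h.q_rec k (by omega)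
    simp only [hk, show i + k + 1 - 1 - i = k by omega,
      show i + k + 1 + 1 - (i + 1) = k + 1 by omega,
      show i + k + 1 + 1 - i = k + 2 by omega, show i + k + 1 + 1 - (i + 2) = k by omega]
    linear_combination h0
  · intro i hi
    rw [List.length_reverse] at hi
    rw [hget i hi]
    obtain ⟨k, hk⟩ : ∃ k, c.length = i + k + 1 := ⟨c.length - i - 1, by omega⟩
    have h0 := h.p_rec k (by omega)
    simp only [hk, show i + k + 1 - 1 - i = k by omega,
      show i + k + 1 + 1 - (i + 1) = k + 1 by omega,
      show i + k + 1 + 1 - i = k + 2 by omega, show i + k + 1 + 1 - (i + 2) = k by omega]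
    linear_combination h0
  · have h0 := h.wedge_zero_one
    simp only [wedge] at h0
    simp only [wedge, tsub_zero, add_tsub_cancel_right, hp, hq, hp', hq']
    linarith
  · intro i j h1 h2 h3
    rw [List.length_reverse] at h3
    have h0 := h.wedge_pos (c.length + 1 - j) (c.length + 1 - i) (by omega) (by omega) (by omega)
    simp only [wedge] at h0 ⊢
    linarith

theorem expand {a b : ℤ} {t : List ℤ} (h : Realizes (a :: b :: t) p q) :
    Realizes ((a + 1) :: 1 :: (b + 1) :: t)
      (fun i => if i ≤ 1 then p i else if i = 2 then p 1 + p 2 else p (i - 1))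
      (fun i => if i ≤ 1 then q i else if i = 2 then q 1 + q 2 else q (i - 1)) := by
  have hrec : ∀ r : ℕ → ℤ,
      (∀ i < (a :: b :: t).length, (a :: b :: t).getD i 0 * r (i + 1) = r i + r (i + 2)) →
      ∀ i < ((a + 1) :: 1 :: (b + 1) :: t).length, ∀ s : ℕ → ℤ,
      (s = fun i => if i ≤ 1 then r i else if i = 2 then r 1 + r 2 else r (i - 1)) →
      ((a + 1) :: 1 :: (b + 1) :: t).getD i 0 * s (i + 1) = s i + s (i + 2) := by
    rintro r hr i hi s rfl
    have r0 := hr 0 (by simp)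
    have r1 := hr 1 (by simp)
    match i, hi with
    | 0, _ =>
      simp at r0 ⊢
      linear_combination r0
    | 1, _ => simp
    | 2, _ =>
      simp at r1 ⊢
      linear_combination r1
    | k + 3, hi =>
      have r2 := hr (k + 2) (by simpa using hi)
      simpa using r2
  constructor
  · simpa using h.p_length
  · simpa using h.q_length
  · simpa using h.p_length_succ
  · simpa using h.q_length_succ
  · exact fun i hi => hrec p h.p_rec i hi _ rfl
  · exact fun i hi => hrec q h.q_rec i hi _ rfl
  · simpa [wedge] using h.wedge_zero_one
  · intro i j h1 h2 h3
    simp only [List.length_cons] at h3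
    have hpos := h.wedge_pos
    simp only [List.length_cons, wedge] at hpos
    have h12 := hpos 1 2 le_rfl (by omega) (by omega)
    match i, j with
    | 0, _ => omega
    | _, 0 => omega
    | _, 1 => omega
    | 1, 2 =>
      simp [wedge]
      linarith
    | 1, k + 3 =>
      simpa [wedge] using hpos 1 (k + 2) le_rfl (by omega) (by omega)
    | 2, k + 3 =>
      have h4 := hpos 1 (k + 2) le_rfl (by omega) (by omega)
      have h5 : 0 ≤ p 2 * q (k + 2) - q 2 * p (k + 2) := by
        rcases Nat.eq_zero_or_pos k with rfl | hk
        · simp [mul_comm]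
        · exact (hpos 2 (k + 2) (by omega) (by omega) (by omega)).le
      simp [wedge]
      linarith
    | k + 3, l + 3 =>
      simpa [wedge] using hpos (k + 2) (l + 2) (by omega) (by omega) (by omega)
    | k + 3, 2 => omega
    | 2, 2 => omega

end Realizes

theorem IsEta.two_le_length {c : List ℤ} (h : IsEta c) : 2 ≤ c.length := by
  induction h with
  | base => simp
  | rotate _ ih => simpa using ih
  | reverse _ ih => simpa using ih
  | expand _ _ => simp

theorem IsEta.exists_realizes {c : List ℤ} (h : IsEta c) : ∃ p q, Realizes c p q := by
  induction h with
  | base => exact ⟨_, _, Realizes.base⟩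
  | rotate hc ih =>
    obtain ⟨p, q, h⟩ := ih
    exact ⟨_, _, h.rotate hc.two_le_length⟩
  | reverse _ ih =>
    obtain ⟨p, q, h⟩ := ih
    exact ⟨_, _, h.reverse⟩
  | expand _ ih =>
    obtain ⟨p, q, h⟩ := ih
    exact ⟨_, _, h.expand⟩

namespace Realizes

variable {c : List ℤ} {p q : ℕ → ℤ}

theorem prod_map_etaM (h : Realizes c p q) (i k : ℕ) (hk : i + k ≤ c.length) :
    (((c.drop i).take k).map etaM).prod 1 0 = wedge p q (i + 1) (i + 1 + k) ∧
    (((c.drop i).take k).map etaM).prod 1 1 = -wedge p q (i + 1) (i + k) := by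
  induction k with
  | zero =>
    by_cases hi : i ≤ c.length
    · have h0 := h.wedge_succ hi
      simp only [wedge] at h0
      simp only [List.take_zero, List.map_nil, List.prod_nil, wedge, add_zero]
      constructor
      · simp [mul_comm]
      · simp only [Matrix.one_apply_eq]
        linarith
    · omega
  | succ k ih =>
    obtain ⟨h1, h2⟩ := ih (by omega)
    have hlt : k < (c.drop i).length := by
      rw [List.length_drop]
      omega
    have h3 := h.p_rec (i + k) (by omega)
    have h4 := h.q_rec (i + k) (by omega)
    rw [List.getD_eq_getElem _ _ (by omega)] at h3 h4
    rw [List.take_succ_eq_append_getElem hlt, List.map_append, List.prod_append]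
    simp only [List.map_cons, List.map_nil, List.prod_cons, List.prod_nil, mul_one,
      Matrix.mul_apply, Fin.sum_univ_two, h1, h2, List.getElem_drop, etaM]
    simp only [wedge, show i + 1 + k = i + k + 1 by ring,
      show i + 1 + (k + 1) = i + k + 2 by ring, show i + (k + 1) = i + k + 1 by ring]
    constructor
    · simp
      linear_combination p (i + 1) * h4 - q (i + 1) * h3
    · simp

theorem phi_eq (h : Realizes c p q) {i j : ℕ} (hi : 1 ≤ i) (hij : i ≤ j) (hj : j ≤ c.length) :
    phi c i j = wedge p q i j ∧ phi c j i = wedge p q i j := by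
  rcases eq_or_lt_of_le hij with rfl | hlt
  · simp [phi, wedge, mul_comm]
  · have h0 := (h.prod_map_etaM (i - 1) (j - i) (by omega)).1
    rw [show i - 1 + 1 = i by omega, show i + (j - i) = j by omega] at h0
    exact ⟨by rw [phi, if_neg hlt.ne, if_pos hlt, h0],
      by rw [phi, if_neg hlt.ne', if_neg hlt.not_gt, h0]⟩

end Realizes

/-- An `n`-antiperiodic planar sequence of vectors turning counterclockwise, consecutive ones
spanning the unit lattice. -/
structure IsTurning (n : ℕ) (p q : ℕ → ℤ) : Prop where
  p_add : ∀ i, p (i + n) = -p i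
  q_add : ∀ i, q (i + n) = -q i
  wedge_succ : ∀ i, wedge p q i (i + 1) = 1
  wedge_pos : ∀ i j, i < j → j < i + n → 0 < wedge p q i j

/-- The positions in `(i, i + n)` at which the determinant with the `i`-th vector is maximal. -/
def argmaxWedge (n : ℕ) (p q : ℕ → ℤ) (i : ℕ) : Finset ℕ :=
  (Finset.Ioo i (i + n)).filter
    (fun j => ∀ l ∈ Finset.Ioo i (i + n), wedge p q i l ≤ wedge p q i j)

theorem mem_mset {c : List ℤ} {i j : ℕ} : j ∈ mset c i ↔
    j ∈ Finset.Icc 1 c.length ∧ ∀ l ∈ Finset.Icc 1 c.length, phi c i l ≤ phi c i j := by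
  classical
  simp [mset]

theorem exists_isTurning {c : List ℤ} (h : IsEta c) :
    ∃ p q, IsTurning c.length p q ∧
      ∀ i ∈ Finset.Icc 1 c.length, (mset c i).card = (argmaxWedge c.length p q i).card := by
  obtain ⟨p, q, hr⟩ := h.exists_realizes
  have hn := h.two_le_length
  set n := c.length with hn_def
  let ext : (ℕ → ℤ) → ℕ → ℤ := fun r i => (-1) ^ (i / n) * r (i % n)
  have ext_add : ∀ r i, ext r (i + n) = -ext r i := by
    intro r i
    simp only [ext, Nat.add_div_right i (show 0 < n by omega), Nat.add_mod_right]
    ring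
  have ext_eq : ∀ r : ℕ → ℤ, r n = -r 0 → ∀ i ≤ n, ext r i = r i := by
    intro r hr0 i hi
    rcases eq_or_lt_of_le hi with hi | hi
    · rw [hi]
      simp [ext, Nat.div_self (show 0 < n by omega), hr0]
    · simp [ext, Nat.div_eq_of_lt hi, Nat.mod_eq_of_lt hi]
  have hp := ext_eq p hr.p_length
  have hq := ext_eq q hr.q_length
  have w_eq : ∀ i ≤ n, ∀ j ≤ n, wedge (ext p) (ext q) i j = wedge p q i j := by
    intro i hi j hj
    simp only [wedge, hp i hi, hp j hj, hq i hi, hq j hj]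
  have w_swap : ∀ i j, wedge (ext p) (ext q) i (j + n) = wedge (ext p) (ext q) j i := by
    intro i j
    simp only [wedge, ext_add]
    ring
  have w_add : ∀ i j, wedge (ext p) (ext q) (i + n) (j + n) = wedge (ext p) (ext q) i j := by
    intro i j
    simp only [wedge, ext_add]
    ring
  have small : ∀ i < n, ∀ j, i < j → j < i + n → 0 < wedge (ext p) (ext q) i j := by
    intro i hi j hij hj
    rcases Nat.eq_zero_or_pos i with rfl | hi0
    · have h1 := hr.wedge_pos j n hij (by omega) le_rfl
      rw [← w_eq j (by omega) n le_rfl] at h1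
      have h2 := w_swap j 0
      rw [zero_add] at h2
      rwa [h2] at h1
    · by_cases hjn : j ≤ n
      · rw [w_eq i hi.le j hjn]
        exact hr.wedge_pos i j hi0 hij hjn
      · obtain ⟨k, rfl⟩ : ∃ k, j = k + n := ⟨j - n, by omega⟩
        rw [w_swap, w_eq k (by omega) i hi.le]
        exact hr.wedge_pos k i (by omega) (by omega) hi.le
  have succ_small : ∀ i < n, wedge (ext p) (ext q) i (i + 1) = 1 := by
    intro i hi
    rw [w_eq i hi.le (i + 1) hi]
    exact hr.wedge_succ hi.le
  have key : IsTurning n (ext p) (ext q) := by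
    refine ⟨ext_add p, ext_add q, ?_, ?_⟩
    · intro i
      induction i using Nat.strong_induction_on with
      | _ i ih =>
        by_cases hi : i < n
        · exact succ_small i hi
        · obtain ⟨k, rfl⟩ : ∃ k, i = k + n := ⟨i - n, by omega⟩
          rw [show k + n + 1 = k + 1 + n by ring, w_add]
          exact ih k (by omega)
    · intro i
      induction i using Nat.strong_induction_on with
      | _ i ih =>
        intro j hij hj
        by_cases hi : i < n
        · exact small i hi j hij hj
        · obtain ⟨k, rfl⟩ : ∃ k, i = k + n := ⟨i - n, by omega⟩
          obtain ⟨l, rfl⟩ : ∃ l, j = l + n := ⟨j - n, by omega⟩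
          rw [w_add]
          exact ih k (by omega) l (by omega) (by omega)
  refine ⟨ext p, ext q, key, ?_⟩
  intro i hi
  rw [Finset.mem_Icc] at hi
  have phi_of_le : ∀ j, i ≤ j → j ≤ n → phi c i j = wedge (ext p) (ext q) i j := by
    intro j h1 h2
    rw [w_eq i hi.2 j h2]
    exact (hr.phi_eq hi.1 h1 h2).1
  have phi_of_lt : ∀ j, 1 ≤ j → j < i → phi c i j = wedge (ext p) (ext q) i (j + n) := by
    intro j h1 h2
    rw [w_swap, w_eq j (by omega) i hi.2]
    exact (hr.phi_eq h1 h2.le hi.2).2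
  have up : ∀ j ∈ Finset.Icc 1 n, j ≠ i →
      (if i < j then j else j + n) ∈ Finset.Ioo i (i + n) ∧
      phi c i j = wedge (ext p) (ext q) i (if i < j then j else j + n) := by
    intro j hj hne
    rw [Finset.mem_Icc] at hj
    split_ifs with hlt
    · exact ⟨Finset.mem_Ioo.2 ⟨hlt, by omega⟩, phi_of_le j hlt.le hj.2⟩
    · exact ⟨Finset.mem_Ioo.2 ⟨by omega, by omega⟩, phi_of_lt j hj.1 (by omega)⟩
  have down : ∀ k ∈ Finset.Ioo i (i + n),
      (if k ≤ n then k else k - n) ∈ Finset.Icc 1 n ∧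
      phi c i (if k ≤ n then k else k - n) = wedge (ext p) (ext q) i k := by
    intro k hk
    rw [Finset.mem_Ioo] at hk
    split_ifs with hle
    · exact ⟨Finset.mem_Icc.2 ⟨by omega, hle⟩, phi_of_le k hk.1.le hle⟩
    · refine ⟨Finset.mem_Icc.2 ⟨by omega, by omega⟩, ?_⟩
      rw [phi_of_lt (k - n) (by omega) (by omega), Nat.sub_add_cancel (by omega)]
  have ne_of_mem : ∀ j ∈ mset c i, j ≠ i := by
    rintro j hj rfl
    obtain ⟨-, hmax⟩ := mem_mset.1 hj
    obtain ⟨h1, h2⟩ := down (j + 1) (Finset.mem_Ioo.2 ⟨by omega, by omega⟩)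
    have h3 := hmax _ h1
    rw [h2, key.wedge_succ, phi, if_pos rfl] at h3
    omega
  refine Finset.card_nbij' (fun j => if i < j then j else j + n)
    (fun k => if k ≤ n then k else k - n) ?_ ?_ ?_ ?_
  · intro j hj
    have hne := ne_of_mem j hj
    obtain ⟨hj1, hmax⟩ := mem_mset.1 hj
    obtain ⟨h1, h2⟩ := up j hj1 hne
    refine Finset.mem_coe.2 (Finset.mem_filter.2 ⟨h1, fun l hl => ?_⟩)
    obtain ⟨h3, h4⟩ := down l hl
    rw [← h2, ← h4]
    exact hmax _ h3
  · intro k hk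
    obtain ⟨hk1, hmax⟩ := Finset.mem_filter.1 hk
    obtain ⟨h1, h2⟩ := down k hk1
    refine Finset.mem_coe.2 (mem_mset.2 ⟨h1, fun l hl => ?_⟩)
    dsimp only
    rw [h2]
    by_cases hli : l = i
    · subst hli
      rw [phi, if_pos rfl]
      rw [Finset.mem_Ioo] at hk1
      exact (key.wedge_pos _ _ hk1.1 hk1.2).le
    · obtain ⟨h3, h4⟩ := up l hl hli
      rw [h4]
      exact hmax _ h3
  · intro j hj
    have hne := ne_of_mem j hj
    have hj1 := Finset.mem_Icc.1 (mem_mset.1 hj).1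
    dsimp only
    split_ifs <;> omega
  · intro k hk
    have hk1 := Finset.mem_Ioo.1 (Finset.mem_filter.1 hk).1
    dsimp only
    split_ifs <;> omega

namespace IsTurning

variable {n : ℕ} {p q : ℕ → ℤ}

theorem argmaxWedge_nonempty (hn : 2 ≤ n) (i : ℕ) : (argmaxWedge n p q i).Nonempty := by
  obtain ⟨j, hj, hmax⟩ := (Finset.Ioo i (i + n)).exists_max_image (wedge p q i)
    ⟨i + 1, Finset.mem_Ioo.2 ⟨by omega, by omega⟩⟩
  exact ⟨j, Finset.mem_filter.2 ⟨hj, hmax⟩⟩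

theorem add_mem_argmaxWedge (h : IsTurning n p q) {i j : ℕ} (hj : j ∈ argmaxWedge n p q i) :
    j + n ∈ argmaxWedge n p q (i + n) := by
  have w_add : ∀ i j, wedge p q (i + n) (j + n) = wedge p q i j := by
    intro i j
    simp only [wedge, h.p_add, h.q_add]
    ring
  obtain ⟨h1, h2⟩ := Finset.mem_filter.1 hj
  rw [Finset.mem_Ioo] at h1
  refine Finset.mem_filter.2 ⟨Finset.mem_Ioo.2 ⟨by omega, by omega⟩, fun l hl => ?_⟩
  rw [Finset.mem_Ioo] at hl
  obtain ⟨k, rfl⟩ : ∃ k, l = k + n := ⟨l - n, by omega⟩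
  rw [w_add, w_add]
  exact h2 k (Finset.mem_Ioo.2 ⟨by omega, by omega⟩)

theorem argmaxWedge_add (h : IsTurning n p q) (i : ℕ) :
    argmaxWedge n p q (i + n) = (argmaxWedge n p q i).image (· + n) := by
  have w_add : ∀ i j, wedge p q (i + n) (j + n) = wedge p q i j := by
    intro i j
    simp only [wedge, h.p_add, h.q_add]
    ring
  ext j
  rw [Finset.mem_image]
  constructor
  · intro hj
    obtain ⟨h1, h2⟩ := Finset.mem_filter.1 hj
    rw [Finset.mem_Ioo] at h1
    obtain ⟨k, rfl⟩ : ∃ k, j = k + n := ⟨j - n, by omega⟩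
    refine ⟨k, Finset.mem_filter.2 ⟨Finset.mem_Ioo.2 ⟨by omega, by omega⟩, fun l hl => ?_⟩, rfl⟩
    rw [Finset.mem_Ioo] at hl
    have h3 := h2 (l + n) (Finset.mem_Ioo.2 ⟨by omega, by omega⟩)
    rwa [w_add, w_add] at h3
  · rintro ⟨k, hk, rfl⟩
    exact h.add_mem_argmaxWedge hk

theorem card_argmaxWedge_add (h : IsTurning n p q) (i : ℕ) :
    (argmaxWedge n p q (i + n)).card = (argmaxWedge n p q i).card := by
  rw [h.argmaxWedge_add, Finset.card_image_of_injective _ (add_left_injective n)]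

/-- The positions of the maxima move monotonically with the base point. -/
theorem le_of_mem_argmaxWedge_succ (h : IsTurning n p q) {i j k : ℕ}
    (hj : j ∈ argmaxWedge n p q i) (hk : k ∈ argmaxWedge n p q (i + 1)) : j ≤ k := by
  by_contra! hlt
  obtain ⟨hj1, hj2⟩ := Finset.mem_filter.1 hj
  obtain ⟨hk1, hk2⟩ := Finset.mem_filter.1 hk
  rw [Finset.mem_Ioo] at hj1 hk1
  have h1 := hj2 k (Finset.mem_Ioo.2 ⟨by omega, by omega⟩)
  have h2 := hk2 j (Finset.mem_Ioo.2 ⟨by omega, by omega⟩)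
  have h3 := h.wedge_pos k j hlt (by omega)
  have h4 := h.wedge_pos i j hj1.1 hj1.2
  have h5 := h.wedge_pos (i + 1) j (by omega) (by omega)
  have h6 : wedge p q i k * wedge p q (i + 1) j =
      wedge p q i j * wedge p q (i + 1) k + wedge p q i (i + 1) * wedge p q k j := by
    simp only [wedge]
    ring
  rw [h.wedge_succ] at h6
  have h7 := mul_le_mul h1 h2 h5.le h4.le
  linarith

/-- Maxima at adjacent positions occur only for the centre of a fan. -/
theorem argmaxWedge_eq_of_adjacent (h : IsTurning n p q) {i j : ℕ}
    (hj : j ∈ argmaxWedge n p q i) (hj' : j + 1 ∈ argmaxWedge n p q i) :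
    argmaxWedge n p q i = Finset.Ioo i (i + n) := by
  obtain ⟨h1, h2⟩ := Finset.mem_filter.1 hj
  obtain ⟨h1', h2'⟩ := Finset.mem_filter.1 hj'
  have heq : wedge p q i (j + 1) = wedge p q i j := le_antisymm (h2 _ h1') (h2' _ h1)
  have hplu : wedge p q i j * wedge p q (i + 1) (j + 1) =
      wedge p q i (j + 1) * wedge p q (i + 1) j + wedge p q i (i + 1) * wedge p q j (j + 1) := by
    simp only [wedge]
    ring
  rw [h.wedge_succ, h.wedge_succ, heq] at hplu
  rw [Finset.mem_Ioo] at h1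
  have hpos := h.wedge_pos i j h1.1 h1.2
  have hone : wedge p q i j = 1 :=
    Int.eq_one_of_dvd_one hpos.le
      ⟨wedge p q (i + 1) (j + 1) - wedge p q (i + 1) j, by linear_combination -hplu⟩
  refine Finset.filter_true_of_mem fun k hk l hl => (h2 l hl).trans ?_
  rw [Finset.mem_Ioo] at hk
  have := h.wedge_pos i k hk.1 hk.2
  omega

theorem card_argmaxWedge_of_dense (h : IsTurning n p q) (hn : 4 < n)
    (hd : ∀ i, 1 ≤ i → i ≤ n →
      1 < (argmaxWedge n p q i).card ∨ 1 < (argmaxWedge n p q (i + 1)).card)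
    {i : ℕ} (hi : 1 ≤ i) (hin : i ≤ n) :
    ((argmaxWedge n p q i).card = 1 ∧ (argmaxWedge n p q (i + 1)).card = 2) ∨
    ((argmaxWedge n p q i).card = 2 ∧ (argmaxWedge n p q (i + 1)).card = 1) := by
  have hne : ∀ i, (argmaxWedge n p q i).Nonempty := argmaxWedge_nonempty (by omega)
  let lo : ℕ → ℕ := fun i => (argmaxWedge n p q i).min' (hne i)
  let hi' : ℕ → ℕ := fun i => (argmaxWedge n p q i).max' (hne i)
  have lo_mem : ∀ i, lo i ∈ argmaxWedge n p q i := fun i => Finset.min'_mem _ _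
  have hi_mem : ∀ i, hi' i ∈ argmaxWedge n p q i := fun i => Finset.max'_mem _ _
  have lo_le : ∀ i, ∀ j ∈ argmaxWedge n p q i, lo i ≤ j := fun i j hj => Finset.min'_le _ _ hj
  have le_hi : ∀ i, ∀ j ∈ argmaxWedge n p q i, j ≤ hi' i := fun i j hj => Finset.le_max' _ _ hj
  have step : ∀ i, hi' i ≤ lo (i + 1) :=
    fun i => h.le_of_mem_argmaxWedge_succ (hi_mem i) (lo_mem (i + 1))
  have lo_hi : ∀ i, lo i ≤ hi' i := fun i => lo_le i _ (hi_mem i)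
  have lo_add : ∀ i, lo (i + n) = lo i + n := by
    intro i
    refine le_antisymm (lo_le _ _ (h.add_mem_argmaxWedge (lo_mem i))) ?_
    have h1 := lo_mem (i + n)
    rw [h.argmaxWedge_add, Finset.mem_image] at h1
    obtain ⟨k, hk, hk'⟩ := h1
    have := lo_le i k hk
    omega
  have adj : ∀ i j, j ∈ argmaxWedge n p q i → j + 1 ∈ argmaxWedge n p q i →
      lo i + 3 ≤ hi' i := by
    intro i j hj hj'
    have h1 := h.argmaxWedge_eq_of_adjacent hj hj'
    have h2 := lo_le i (i + 1) (by rw [h1, Finset.mem_Ioo]; omega)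
    have h3 := le_hi i (i + n - 1) (by rw [h1, Finset.mem_Ioo]; omega)
    omega
  have wide : ∀ i, 1 < (argmaxWedge n p q i).card → lo i + 2 ≤ hi' i := by
    intro i hi
    have h1 : lo i < hi' i := Finset.min'_lt_max'_of_card _ hi
    by_contra! h2
    have h3 : hi' i = lo i + 1 := by omega
    have h4 := adj i (lo i) (lo_mem i) (h3 ▸ hi_mem i)
    omega
  have narrow : ∀ i, hi' i ≤ lo i + 2 → (argmaxWedge n p q i).card ≤ 2 := by
    intro i hi
    have hsub : argmaxWedge n p q i ⊆ {lo i, lo i + 2} := by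
      intro j hj
      have h1 := lo_le i j hj
      have h2 := le_hi i j hj
      have h3 : j ≠ lo i + 1 := by
        rintro rfl
        have := adj i (lo i) (lo_mem i) hj
        omega
      simp only [Finset.mem_insert, Finset.mem_singleton]
      omega
    exact (Finset.card_le_card hsub).trans Finset.card_le_two
  have gap : ∀ i ∈ Finset.Icc 1 n, lo i + 2 ≤ lo (i + 2) := by
    intro i hi
    rw [Finset.mem_Icc] at hi
    have h1 := step i
    have h2 : hi' (i + 1) ≤ lo (i + 2) := step (i + 1)
    have h3 := lo_hi i
    have h4 := lo_hi (i + 1)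
    rcases hd i hi.1 hi.2 with hw | hw
    · have := wide _ hw
      omega
    · have := wide _ hw
      omega
  have total : ∑ i ∈ Finset.Icc 1 n, (lo i + 2) = ∑ i ∈ Finset.Icc 1 n, lo (i + 2) := by
    have tele : ∀ m, ∑ i ∈ Finset.Icc 1 m, lo (i + 2) + lo 1 + lo 2 =
        ∑ i ∈ Finset.Icc 1 m, lo i + lo (m + 1) + lo (m + 2) := by
      intro m
      induction m with
      | zero => simp
      | succ m ih =>
        rw [Finset.sum_Icc_succ_top (by omega), Finset.sum_Icc_succ_top (by omega)]
        rw [show m + 1 + 1 = m + 2 by ring, show m + 1 + 2 = m + 3 by ring]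
        omega
    have h1 := tele n
    rw [add_comm n 1, add_comm n 2, lo_add, lo_add] at h1
    rw [Finset.sum_add_distrib, Finset.sum_const, Nat.card_Icc]
    simp only [smul_eq_mul]
    omega
  have h1 := (Finset.sum_eq_sum_iff_of_le gap).1 total i (Finset.mem_Icc.2 ⟨hi, hin⟩)
  have h2 := step i
  have h3 : hi' (i + 1) ≤ lo (i + 2) := step (i + 1)
  have h4 := lo_hi i
  have h5 := lo_hi (i + 1)
  have h6 := narrow i (by omega)
  have h7 := narrow (i + 1) (by omega)
  have h8 := (hne i).card_pos
  have h9 := (hne (i + 1)).card_pos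
  rcases hd i hi hin with hw | hw
  · have h10 := wide _ hw
    have h11 : ¬ 1 < (argmaxWedge n p q (i + 1)).card := fun hw' => by
      have := wide _ hw'
      omega
    omega
  · have h10 := wide _ hw
    have h11 : ¬ 1 < (argmaxWedge n p q i).card := fun hw' => by
      have := wide _ hw'
      omega
    omega

end IsTurning

/-- A sequence whose consecutive values are `{1, 2}` is determined by parity. -/
theorem eq_one_or_two_of_alternating {n : ℕ} {K : ℕ → ℕ}
    (hK : ∀ i, 1 ≤ i → i < n → (K i = 1 ∧ K (i + 1) = 2) ∨ (K i = 2 ∧ K (i + 1) = 1))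
    {a b : ℕ} (ha : K 1 = a) (hab : a + b = 3) {i : ℕ} (hi : 1 ≤ i) (hin : i ≤ n) :
    (Odd i → K i = a) ∧ (Even i → K i = b) := by
  induction i, hi using Nat.le_induction with
  | base => exact ⟨fun _ => ha, fun h => absurd h (by decide)⟩
  | succ i hi ih =>
    obtain ⟨h1, h2⟩ := ih (by omega)
    have h3 := hK i hi hin
    rw [Nat.odd_add_one, Nat.even_add_one, Nat.not_odd_iff_even, Nat.not_even_iff_odd]
    exact ⟨fun h => by have := h2 h; omega, fun h => by have := h1 h; omega⟩

theorem dense_mset_cards (c : List ℤ) (h : IsEta c) (hd : DenseSeq c)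
    (hn : 4 < c.length) :
    ((∀ i ∈ Finset.Icc 1 c.length, Odd i → (mset c i).card = 1) ∧
     (∀ i ∈ Finset.Icc 1 c.length, Even i → (mset c i).card = 2)) ∨
    ((∀ i ∈ Finset.Icc 1 c.length, Odd i → (mset c i).card = 2) ∧
     (∀ i ∈ Finset.Icc 1 c.length, Even i → (mset c i).card = 1)) := by
  obtain ⟨p, q, ht, hcard⟩ := exists_isTurning h
  set n := c.length with hn_def
  have hd' : ∀ i, 1 ≤ i → i ≤ n →
      1 < (argmaxWedge n p q i).card ∨ 1 < (argmaxWedge n p q (i + 1)).card := by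
    intro i h1 h2
    have h3 := hd i (Finset.mem_Icc.2 ⟨h1, h2⟩)
    rw [hcard i (Finset.mem_Icc.2 ⟨h1, h2⟩), addIdx, ← hn_def] at h3
    split_ifs at h3 with hle
    · rwa [hcard (i + 1) (Finset.mem_Icc.2 ⟨by omega, hle⟩)] at h3
    · obtain rfl : i = n := by omega
      rw [Nat.add_sub_cancel_left, hcard 1 (Finset.mem_Icc.2 ⟨le_rfl, h1⟩)] at h3
      rwa [add_comm n 1, ht.card_argmaxWedge_add]
  have hK : ∀ i, 1 ≤ i → i < n →
      ((mset c i).card = 1 ∧ (mset c (i + 1)).card = 2) ∨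
      ((mset c i).card = 2 ∧ (mset c (i + 1)).card = 1) := by
    intro i h1 h2
    rw [hcard i (Finset.mem_Icc.2 ⟨h1, h2.le⟩), hcard (i + 1) (Finset.mem_Icc.2 ⟨by omega, h2⟩)]
    exact ht.card_argmaxWedge_of_dense hn hd' h1 h2.le
  have alt : ∀ a b, (mset c 1).card = a → a + b = 3 → ∀ i ∈ Finset.Icc 1 n,
      (Odd i → (mset c i).card = a) ∧ (Even i → (mset c i).card = b) := by
    intro a b ha hab i hi
    rw [Finset.mem_Icc] at hi
    exact eq_one_or_two_of_alternating (K := fun i => (mset c i).card) hK ha hab hi.1 hi.2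
  rcases hK 1 le_rfl (by omega) with ⟨h1, -⟩ | ⟨h1, -⟩
  · exact Or.inl ⟨fun i hi => (alt 1 2 h1 rfl i hi).1, fun i hi => (alt 1 2 h1 rfl i hi).2⟩
  · exact Or.inr ⟨fun i hi => (alt 2 1 h1 rfl i hi).1, fun i hi => (alt 2 1 h1 rfl i hi).2⟩
end
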